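/- For every sequence (ε(d))_{d≥1} of positive rational numbers, there exist constants C, D > 0 such that for every d ≥ 1, the Gaussian measure γ_{d+1} of the set of coefficient vectors a = (a_0, …, a_d) ∈ ℝ^{d+1} for which the polynomial P_a(x) = Σ_{j=0}^{d} a_j √((d+1)!/(j!(d-j)!)) x^j is nonzero and has at least ε(d)·√d distinct real roots is at most C · d^{3/2} · exp(−D·ε(d)²). -/

import Mathlib

open MeasureTheory

/-- The standard Gaussian probability measure on `ℝ^N`, with density `e^{−|a|²}/π^{N/2}`
with respect to Lebesgue measure. -/
noncomputable def gaussianMeasure (N : ℕ) : Measure (Fin N → ℝ) :=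
  volume.withDensity fun a =>
    ENNReal.ofReal (Real.exp (-(∑ i, a i ^ 2)) / Real.pi ^ ((N : ℝ) / 2))

/-- The Kostlan polynomial `P_a(x) = Σ_{j=0}^d a_j √((d+1)!/(j!(d−j)!)) x^j` associated to a
coefficient vector `a ∈ ℝ^{d+1}`, as a function of `x ∈ ℝ`. -/
noncomputable def kostlanPoly (d : ℕ) (a : Fin (d + 1) → ℝ) (x : ℝ) : ℝ :=
  ∑ j : Fin (d + 1),
    a j * Real.sqrt ((d + 1).factorial /
      ((j : ℕ).factorial * (d - (j : ℕ)).factorial)) * x ^ (j : ℕ)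

open Polynomial in
/-- A Jensen-type bound: a complex polynomial with `#S` zeros in the disc of radius `r` is small
at the centre compared with its size on the circle of radius `3 r`. -/
lemma norm_eval_zero_sq_mul_le (G : ℂ[X]) (S : Finset ℂ) {r M : ℝ} (hr : 0 < r)
    (hS : ∀ z ∈ S, G.eval z = 0 ∧ ‖z‖ ≤ r)
    (hM : ∀ z : ℂ, ‖z‖ = 3 * r → ‖G.eval z‖ ^ 2 ≤ M) :
    ‖G.eval 0‖ ^ 2 * 4 ^ S.card ≤ M := by
  obtain ⟨H, rfl⟩ : (∏ w ∈ S, (X - C w)) ∣ G := by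
    refine Finset.prod_dvd_of_coprime (fun a _ b _ hab => ?_) fun w hw =>
      dvd_iff_isRoot.2 (hS w hw).1
    exact pairwise_coprime_X_sub_C (s := id) Function.injective_id hab
  have hP : 0 < (2 * r) ^ S.card := by positivity
  have hH : ∀ z ∈ frontier (Metric.ball (0 : ℂ) (3 * r)),
      ‖H.eval z‖ ≤ √M / (2 * r) ^ S.card := by
    intro z hz
    have hz' : ‖z‖ = 3 * r := by
      rw [frontier_ball _ (by positivity)] at hz
      simpa using hz
    rw [le_div_iff₀ hP]
    have hlow : (2 * r) ^ S.card ≤ ∏ w ∈ S, ‖z - w‖ := by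
      rw [← Finset.prod_const]
      refine Finset.prod_le_prod (fun _ _ => by positivity) fun w hw => ?_
      have := norm_sub_norm_le z w
      have := (hS w hw).2
      linarith
    have h := Real.le_sqrt_of_sq_le (hM z hz')
    rw [eval_mul, eval_prod, norm_mul, norm_prod] at h
    simp only [eval_sub, eval_X, eval_C] at h
    nlinarith [norm_nonneg (H.eval z)]
  have hH0 : ‖H.eval 0‖ ≤ √M / (2 * r) ^ S.card :=
    Complex.norm_le_of_forall_mem_frontier_norm_le Metric.isBounded_ball
      H.differentiable.diffContOnCl hH (subset_closure (by simpa using hr))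
  have hup : ∏ w ∈ S, ‖(0 : ℂ) - w‖ ≤ r ^ S.card := by
    rw [← Finset.prod_const]
    exact Finset.prod_le_prod (fun _ _ => norm_nonneg _) fun w hw => by simpa using (hS w hw).2
  have hM0 : 0 ≤ M := (sq_nonneg _).trans (hM (3 * r : ℝ) (by simp [abs_of_pos hr]))
  have key : ‖((∏ w ∈ S, (X - C w)) * H).eval 0‖ * 2 ^ S.card ≤ √M := by
    rw [eval_mul, eval_prod, norm_mul, norm_prod]
    simp only [eval_sub, eval_X, eval_C]
    calc (∏ w ∈ S, ‖(0 : ℂ) - w‖) * ‖H.eval 0‖ * 2 ^ S.card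
        ≤ r ^ S.card * (√M / (2 * r) ^ S.card) * 2 ^ S.card := by gcongr
      _ = √M := by rw [mul_pow]; field_simp
  calc _ = (‖((∏ w ∈ S, (X - C w)) * H).eval 0‖ * 2 ^ S.card) ^ 2 := by
        rw [mul_pow, ← pow_mul, mul_comm S.card 2, pow_mul]; norm_num
    _ ≤ √M ^ 2 := by gcongr
    _ = M := Real.sq_sqrt hM0

/-- The homogeneous Kostlan form `∑ a_j √(d choose j) u^{d-j} v^j`, on `ℂ²`. -/
noncomputable def kostlanForm (d : ℕ) (a : Fin (d + 1) → ℝ) (u v : ℂ) : ℂ :=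
  ∑ j : Fin (d + 1), (a j * √(d.choose j) : ℝ) * (u ^ (d - (j : ℕ)) * v ^ (j : ℕ))

lemma kostlanForm_smul (d : ℕ) (a : Fin (d + 1) → ℝ) (l u v : ℂ) :
    kostlanForm d a (l * u) (l * v) = l ^ d * kostlanForm d a u v := by
  simp only [kostlanForm, Finset.mul_sum]
  refine Finset.sum_congr rfl fun j _ => ?_
  have : l ^ d = l ^ (d - (j : ℕ)) * l ^ (j : ℕ) := by
    rw [← pow_add, Nat.sub_add_cancel (Nat.lt_succ_iff.1 j.2)]
  rw [this, mul_pow, mul_pow]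
  ring

lemma sum_choose_mul_pow (d : ℕ) (x y : ℝ) :
    ∑ j : Fin (d + 1), (d.choose j : ℝ) * (x ^ (d - (j : ℕ)) * y ^ (j : ℕ)) = (x + y) ^ d := by
  rw [add_comm x y, add_pow,
    Fin.sum_univ_eq_sum_range (fun j => (d.choose j : ℝ) * (x ^ (d - j) * y ^ j))]
  exact Finset.sum_congr rfl fun j _ => by ring

lemma norm_kostlanForm_sq_le (d : ℕ) (a : Fin (d + 1) → ℝ) (u v : ℂ) :
    ‖kostlanForm d a u v‖ ^ 2 ≤ (∑ j, a j ^ 2) * (‖u‖ ^ 2 + ‖v‖ ^ 2) ^ d := by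
  have h1 : ‖kostlanForm d a u v‖ ≤
      ∑ j : Fin (d + 1), |a j| * (√(d.choose j) * (‖u‖ ^ (d - (j : ℕ)) * ‖v‖ ^ (j : ℕ))) := by
    refine (norm_sum_le _ _).trans_eq (Finset.sum_congr rfl fun j _ => ?_)
    rw [norm_mul, norm_mul, norm_pow, norm_pow, Complex.norm_real, Real.norm_eq_abs, abs_mul,
      abs_of_nonneg (Real.sqrt_nonneg _), mul_assoc]
  calc ‖kostlanForm d a u v‖ ^ 2
      ≤ (∑ j : Fin (d + 1),
          |a j| * (√(d.choose j) * (‖u‖ ^ (d - (j : ℕ)) * ‖v‖ ^ (j : ℕ)))) ^ 2 := by gcongr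
    _ ≤ _ := Finset.sum_mul_sq_le_sq_mul_sq _ _ _
    _ = _ := by
      rw [← sum_choose_mul_pow]
      congr 1
      · simp
      · refine Finset.sum_congr rfl fun j _ => ?_
        rw [mul_pow, Real.sq_sqrt (by positivity)]
        ring

lemma kostlanPoly_eq_sqrt_mul (d : ℕ) (a : Fin (d + 1) → ℝ) (x : ℝ) :
    (kostlanPoly d a x : ℂ) = √(d + 1 : ℝ) * kostlanForm d a 1 x := by
  rw [kostlanPoly, kostlanForm, Complex.ofReal_sum, Finset.mul_sum]
  refine Finset.sum_congr rfl fun j _ => ?_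
  have : (((d + 1).factorial : ℝ) / ((j : ℕ).factorial * (d - (j : ℕ)).factorial)) =
      (d + 1 : ℝ) * d.choose j := by
    rw [Nat.cast_choose ℝ (Nat.lt_succ_iff.1 j.2), Nat.factorial_succ]
    push_cast
    ring
  rw [this, Real.sqrt_mul (by positivity)]
  push_cast
  ring

open Polynomial in
/-- The Kostlan form restricted to the complex affine line tangent to the unit circle at angle
`θ`. -/
noncomputable def kostlanTangent (d : ℕ) (a : Fin (d + 1) → ℝ) (θ : ℝ) : ℂ[X] :=
  ∑ j : Fin (d + 1), C ((a j * √(d.choose j) : ℝ) : ℂ) *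
    ((C (Real.cos θ : ℂ) - C (Real.sin θ : ℂ) * X) ^ (d - (j : ℕ)) *
      (C (Real.sin θ : ℂ) + C (Real.cos θ : ℂ) * X) ^ (j : ℕ))

lemma eval_kostlanTangent (d : ℕ) (a : Fin (d + 1) → ℝ) (θ : ℝ) (z : ℂ) :
    (kostlanTangent d a θ).eval z =
      kostlanForm d a (Real.cos θ - Real.sin θ * z) (Real.sin θ + Real.cos θ * z) := by
  simp [kostlanTangent, kostlanForm, Polynomial.eval_finsetSum]

lemma norm_rotation_sq (θ : ℝ) (z : ℂ) :
    ‖(Real.cos θ - Real.sin θ * z : ℂ)‖ ^ 2 + ‖(Real.sin θ + Real.cos θ * z : ℂ)‖ ^ 2 =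
      1 + ‖z‖ ^ 2 := by
  simp only [← Complex.normSq_eq_norm_sq, Complex.normSq_apply, Complex.sub_re, Complex.sub_im,
    Complex.add_re, Complex.add_im, Complex.mul_re, Complex.mul_im, Complex.ofReal_re,
    Complex.ofReal_im]
  linear_combination (1 + z.re ^ 2 + z.im ^ 2) * Real.sin_sq_add_cos_sq θ

lemma eval_kostlanTangent_tan (d : ℕ) (a : Fin (d + 1) → ℝ) {θ x : ℝ}
    (hc : Real.cos (Real.arctan x - θ) ≠ 0) (hx : kostlanPoly d a x = 0) :
    (kostlanTangent d a θ).eval (Real.tan (Real.arctan x - θ) : ℂ) = 0 := by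
  set φ := Real.arctan x
  have hφ : Real.cos φ ≠ 0 := (Real.cos_arctan_pos x).ne'
  have hxt : x = Real.sin φ / Real.cos φ := by rw [← Real.tan_eq_sin_div_cos, Real.tan_arctan]
  have h1 : Real.cos θ - Real.sin θ * Real.tan (φ - θ) =
      Real.cos φ / Real.cos (φ - θ) * 1 := by
    have := Real.cos_add (φ - θ) θ
    rw [sub_add_cancel] at this
    rw [Real.tan_eq_sin_div_cos, this]
    field_simp
  have h2 : Real.sin θ + Real.cos θ * Real.tan (φ - θ) =
      Real.cos φ / Real.cos (φ - θ) * x := by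
    have := Real.sin_add (φ - θ) θ
    rw [sub_add_cancel] at this
    have h3 : Real.cos φ / Real.cos (φ - θ) * x = Real.sin φ / Real.cos (φ - θ) := by
      rw [hxt]
      field_simp
    rw [Real.tan_eq_sin_div_cos, h3, this]
    field_simp
    ring
  have hF : kostlanForm d a 1 x = 0 := by
    have := kostlanPoly_eq_sqrt_mul d a x
    rw [hx, Complex.ofReal_zero, eq_comm, mul_eq_zero] at this
    refine this.resolve_left ?_
    exact Complex.ofReal_ne_zero.2 (by positivity)
  rw [eval_kostlanTangent]
  have h1' : (Real.cos θ - Real.sin θ * Real.tan (φ - θ) : ℂ) =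
      (Real.cos φ / Real.cos (φ - θ) : ℝ) * 1 := by exact_mod_cast congrArg Complex.ofReal h1
  have h2' : (Real.sin θ + Real.cos θ * Real.tan (φ - θ) : ℂ) =
      (Real.cos φ / Real.cos (φ - θ) : ℝ) * x := by exact_mod_cast congrArg Complex.ofReal h2
  rw [h1', h2', kostlanForm_smul, hF, mul_zero]

/-- The coefficients of the linear form `a ↦ P_a`, read on the unit circle at angle `θ`. -/
noncomputable def kostlanVector (d : ℕ) (θ : ℝ) (j : Fin (d + 1)) : ℝ :=
  √(d.choose j) * (Real.cos θ ^ (d - (j : ℕ)) * Real.sin θ ^ (j : ℕ))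

lemma sum_kostlanVector_sq (d : ℕ) (θ : ℝ) : ∑ j, kostlanVector d θ j ^ 2 = 1 := by
  have h := sum_choose_mul_pow d (Real.cos θ ^ 2) (Real.sin θ ^ 2)
  rw [Real.cos_sq_add_sin_sq, one_pow] at h
  rw [← h]
  refine Finset.sum_congr rfl fun j _ => ?_
  rw [kostlanVector, mul_pow, Real.sq_sqrt (by positivity)]
  ring

lemma eval_zero_kostlanTangent (d : ℕ) (a : Fin (d + 1) → ℝ) (θ : ℝ) :
    (kostlanTangent d a θ).eval 0 = (∑ j, a j * kostlanVector d θ j : ℝ) := by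
  rw [eval_kostlanTangent]
  simp [kostlanForm, kostlanVector, mul_assoc]

lemma tan_le_two_mul {t : ℝ} (h0 : 0 ≤ t) (h1 : t ≤ 1) : Real.tan t ≤ 2 * t := by
  have hc : 1 / 2 ≤ Real.cos t := by
    have := Real.one_sub_sq_div_two_le_cos (x := t)
    nlinarith
  rw [Real.tan_eq_sin_div_cos, div_le_iff₀ (by linarith)]
  nlinarith [Real.sin_le h0]

/-- If `P_a` has many zeros in an arc of length `h`, it is small at the endpoint of the arc. -/
lemma sum_mul_kostlanVector_sq_le (d : ℕ) (a : Fin (d + 1) → ℝ) {θ h : ℝ} (h0 : 0 < h)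
    (h1 : h ≤ 1) (S : Finset ℝ) (hS : ∀ x ∈ S, kostlanPoly d a x = 0 ∧
      0 ≤ Real.arctan x - θ ∧ Real.arctan x - θ ≤ h) :
    (∑ j, a j * kostlanVector d θ j) ^ 2 * 4 ^ S.card ≤
      (∑ j, a j ^ 2) * Real.exp (36 * d * h ^ 2) := by
  have hpi : h < Real.pi / 2 := by linarith [Real.pi_gt_three]
  have hmem : ∀ x ∈ S, Real.arctan x - θ ∈ Set.Ioo (-(Real.pi / 2)) (Real.pi / 2) := fun x hx =>
    ⟨by linarith [(hS x hx).2.1, Real.pi_pos], by linarith [(hS x hx).2.2]⟩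
  have hinj : Set.InjOn (fun x : ℝ => (Real.tan (Real.arctan x - θ) : ℂ)) S := by
    intro x hx y hy hxy
    have := Real.injOn_tan (hmem x hx) (hmem y hy) (Complex.ofReal_injective hxy)
    exact Real.arctan_injective (by linarith)
  rw [← Finset.card_image_of_injOn hinj]
  have key := norm_eval_zero_sq_mul_le (kostlanTangent d a θ)
    (S.image fun x : ℝ => (Real.tan (Real.arctan x - θ) : ℂ)) (r := 2 * h)
    (M := (∑ j, a j ^ 2) * Real.exp (36 * d * h ^ 2)) (by positivity) ?_ ?_
  · rwa [eval_zero_kostlanTangent, Complex.norm_real, Real.norm_eq_abs, sq_abs] at key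
  · simp only [Finset.mem_image, forall_exists_index, and_imp]
    rintro _ x hx rfl
    refine ⟨eval_kostlanTangent_tan d a (Real.cos_pos_of_mem_Ioo (hmem x hx)).ne' (hS x hx).1, ?_⟩
    have ht := (hS x hx).2
    rw [Complex.norm_real, Real.norm_eq_abs,
      abs_of_nonneg (Real.tan_nonneg_of_nonneg_of_le_pi_div_two ht.1 (hmem x hx).2.le)]
    linarith [tan_le_two_mul ht.1 (ht.2.trans h1)]
  · intro z hz
    rw [eval_kostlanTangent]
    refine (norm_kostlanForm_sq_le _ _ _ _).trans ?_
    rw [norm_rotation_sq]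
    gcongr
    calc (1 + ‖z‖ ^ 2) ^ d ≤ Real.exp (‖z‖ ^ 2) ^ d := by
          gcongr
          linarith [Real.add_one_le_exp (‖z‖ ^ 2)]
      _ = Real.exp (36 * d * h ^ 2) := by
          rw [← Real.exp_nat_mul, hz]
          ring_nf

/-- If `P_a` has many zeros, it is small at one of `m` equidistributed points of the circle. -/
lemma exists_sum_mul_kostlanVector_sq_le (d : ℕ) (a : Fin (d + 1) → ℝ) {m : ℕ} (hm : 4 ≤ m)
    (Z : Finset ℝ) (hZ : ∀ x ∈ Z, kostlanPoly d a x = 0) :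
    ∃ i ∈ Finset.range m,
      (∑ j, a j * kostlanVector d (i * (Real.pi / m) - Real.pi / 2) j) ^ 2 ≤
        (∑ j, a j ^ 2) * Real.exp (36 * d * (Real.pi / m) ^ 2 - Z.card / m) := by
  have hm0 : (0 : ℝ) < m := by positivity
  have hh : 0 < Real.pi / m := by positivity
  have harc : ∀ x, 0 ≤ Real.arctan x + Real.pi / 2 := fun x => by
    linarith [Real.neg_pi_div_two_lt_arctan x]
  obtain ⟨i, hi, hcard⟩ := Finset.exists_le_card_fiber_of_nsmul_le_card_of_maps_to
    (s := Z) (t := Finset.range m) (b := (Z.card / m : ℝ))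
    (f := fun x => ⌊(Real.arctan x + Real.pi / 2) / (Real.pi / m)⌋₊) (fun x _ => by
      rw [Finset.mem_range, Nat.floor_lt (div_nonneg (harc x) hh.le), div_lt_iff₀ hh,
        mul_div_cancel₀ _ hm0.ne']
      linarith [Real.arctan_lt_pi_div_two x]) ⟨0, by simp; omega⟩ (by
      rw [Finset.card_range, nsmul_eq_mul, mul_div_cancel₀ _ hm0.ne'])
  refine ⟨i, hi, ?_⟩
  set S := Z.filter fun x => ⌊(Real.arctan x + Real.pi / 2) / (Real.pi / m)⌋₊ = i
  have key := sum_mul_kostlanVector_sq_le d a (θ := i * (Real.pi / m) - Real.pi / 2) hh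
    (by
      rw [div_le_one hm0]
      have : (4 : ℝ) ≤ m := by exact_mod_cast hm
      linarith [Real.pi_le_four]) S (fun x hx => by
      obtain ⟨hxZ, hxi⟩ := Finset.mem_filter.1 hx
      have h1 := Nat.floor_le (div_nonneg (harc x) hh.le)
      have h2 := Nat.lt_floor_add_one ((Real.arctan x + Real.pi / 2) / (Real.pi / m))
      rw [hxi] at h1 h2
      rw [le_div_iff₀ hh] at h1
      rw [div_lt_iff₀ hh] at h2
      exact ⟨hZ x hxZ, by linarith, by linarith⟩)
  have hexp : Real.exp (Z.card / m) ≤ 4 ^ S.card := by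
    calc Real.exp (Z.card / m) ≤ Real.exp (S.card * 1) := by
          rw [mul_one]; exact Real.exp_le_exp.2 hcard
      _ = Real.exp 1 ^ S.card := Real.exp_nat_mul _ _
      _ ≤ 4 ^ S.card := by
          gcongr
          linarith [Real.exp_one_lt_d9]
  rw [Real.exp_sub, ← mul_div_assoc (∑ j, a j ^ 2), le_div_iff₀ (Real.exp_pos _)]
  exact (mul_le_mul_of_nonneg_left hexp (sq_nonneg _)).trans key

lemma exists_kostlan_small (d : ℕ) (hd : 1 ≤ d) (a : Fin (d + 1) → ℝ) {e : ℝ} (he : 0 < e)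
    (hed : e ≤ √d) (hN : e * √d ≤ Set.ncard {x : ℝ | kostlanPoly d a x = 0}) :
    ∃ i ∈ Finset.range ⌈1000 * √d / e⌉₊,
      (∑ j, a j * kostlanVector d
        (i * (Real.pi / (⌈1000 * √d / e⌉₊ : ℕ)) - Real.pi / 2) j) ^ 2 ≤
        (∑ j, a j ^ 2) * Real.exp (-e ^ 2 / 4000) := by
  set m := ⌈1000 * √d / e⌉₊
  have hs : 0 < √(d : ℝ) := Real.sqrt_pos.2 (by exact_mod_cast hd)
  have hsd : √(d : ℝ) ^ 2 = d := Real.sq_sqrt (by positivity)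
  have hs1 : 1 ≤ √(d : ℝ) / e := by rwa [one_le_div he]
  have hm1 : 1000 * √(d : ℝ) / e ≤ m := Nat.le_ceil _
  have hm2 : (m : ℝ) < 1000 * √(d : ℝ) / e + 1 := Nat.ceil_lt_add_one (by positivity)
  rw [mul_div_assoc] at hm1 hm2
  have hm1000 : (1000 : ℝ) ≤ m := by linarith
  have hm3 : (m : ℝ) ≤ 1001 * (√d / e) := by linarith
  have hfin : {x : ℝ | kostlanPoly d a x = 0}.Finite := by
    refine Set.finite_of_ncard_pos ?_
    have : (0 : ℝ) < Set.ncard {x : ℝ | kostlanPoly d a x = 0} := lt_of_lt_of_le (by positivity) hN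
    exact_mod_cast this
  obtain ⟨i, hi, h⟩ := exists_sum_mul_kostlanVector_sq_le d a (m := m)
    (by exact_mod_cast (by linarith : (4 : ℝ) ≤ m)) hfin.toFinset
    (fun x hx => hfin.mem_toFinset.1 hx)
  refine ⟨i, hi, h.trans ?_⟩
  rw [← Set.ncard_eq_toFinset_card _ hfin]
  have hmpos : (0 : ℝ) < m := by linarith
  gcongr
  have h1 : e ^ 2 / 1001 ≤ Set.ncard {x : ℝ | kostlanPoly d a x = 0} / (m : ℝ) := by
    rw [div_le_div_iff₀ (by norm_num) hmpos]
    calc e ^ 2 * m ≤ e ^ 2 * (1001 * (√d / e)) := by gcongr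
      _ = e * √d * 1001 := by field_simp
      _ ≤ _ := by gcongr
  have h2 : 36 * d * (Real.pi / m) ^ 2 ≤ e ^ 2 * (36 * 16 / 1000 ^ 2) := by
    calc 36 * d * (Real.pi / m) ^ 2 ≤ 36 * d * (4 / (1000 * (√d / e))) ^ 2 := by
          gcongr
          exact Real.pi_le_four
      _ = 36 * √(d : ℝ) ^ 2 * (4 / (1000 * (√d / e))) ^ 2 := by rw [hsd]
      _ = _ := by
        field_simp
        norm_num
  linarith [sq_nonneg e]

open ProbabilityTheory

lemma gaussianMeasure_eq_pi (N : ℕ) :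
    gaussianMeasure N = Measure.pi fun _ => gaussianReal 0 (1 / 2) := by
  have hv : (1 / 2 : NNReal) ≠ 0 := by norm_num
  symm
  refine Measure.pi_eq fun s hs => ?_
  have hdens : ∀ a : Fin N → ℝ, Real.exp (-(∑ i, a i ^ 2)) / Real.pi ^ ((N : ℝ) / 2) =
      ∏ i, gaussianPDFReal 0 (1 / 2) (a i) := by
    intro a
    simp only [gaussianPDFReal, Finset.prod_mul_distrib, ← Real.exp_sum]
    have h1 : √(2 * Real.pi * ((1 / 2 : NNReal) : ℝ)) = Real.pi ^ (1 / 2 : ℝ) := by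
      rw [Real.sqrt_eq_rpow]
      congr 1
      push_cast
      ring
    rw [h1, Finset.prod_const, Finset.card_univ, Fintype.card_fin, inv_pow, ← Real.rpow_natCast,
      ← Real.rpow_mul Real.pi_pos.le, div_eq_inv_mul]
    congr 2
    · congr 1
      ring
    · rw [← Finset.sum_neg_distrib]
      refine Finset.sum_congr rfl fun i _ => ?_
      push_cast
      ring
  have hint : ∀ i, Integrable (gaussianPDFReal 0 (1 / 2)) (volume.restrict (s i)) := fun i =>
    (integrable_gaussianPDFReal 0 (1 / 2)).restrict
  have hint' : Integrable (fun a : Fin N → ℝ => ∏ i, gaussianPDFReal 0 (1 / 2) (a i))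
      (Measure.pi fun i => volume.restrict (s i)) := Integrable.fintype_prod hint
  rw [gaussianMeasure, withDensity_apply _ (MeasurableSet.univ_pi hs), volume_pi,
    Measure.restrict_pi_pi]
  simp_rw [hdens, gaussianReal_apply_eq_integral 0 hv]
  rw [← ofReal_integral_eq_lintegral_ofReal hint'
    (ae_of_all _ fun a => Finset.prod_nonneg fun i _ => gaussianPDFReal_nonneg _ _ _),
    integral_fintype_prod_eq_prod, ENNReal.ofReal_prod_of_nonneg]
  exact fun i _ => integral_nonneg fun x => gaussianPDFReal_nonneg _ _ _

lemma map_sum_mul_gaussianMeasure {N : ℕ} (v : Fin N → ℝ) (hv : ∑ i, v i ^ 2 = 1) :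
    (gaussianMeasure N).map (fun a => ∑ i, a i * v i) = gaussianReal 0 (1 / 2) := by
  rw [gaussianMeasure_eq_pi]
  have hmeas : Measurable fun a : Fin N → ℝ => ∑ i, a i * v i := by fun_prop
  have := Measure.isProbabilityMeasure_map (μ := Measure.pi fun _ : Fin N =>
    gaussianReal 0 (1 / 2)) hmeas.aemeasurable
  refine Measure.ext_of_charFun ?_
  ext t
  rw [charFun_apply_real, integral_map hmeas.aemeasurable (by fun_prop)]
  have h : ∀ a : Fin N → ℝ, Complex.exp (t * (∑ i, a i * v i : ℝ) * Complex.I) =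
      ∏ i, Complex.exp ((t * v i : ℝ) * a i * Complex.I) := by
    intro a
    rw [← Complex.exp_sum]
    congr 1
    push_cast
    rw [Finset.mul_sum, Finset.sum_mul]
    exact Finset.sum_congr rfl fun i _ => by ring
  simp_rw [h]
  rw [integral_fintype_prod_eq_prod
    (f := fun i (x : ℝ) => Complex.exp ((t * v i : ℝ) * x * Complex.I))]
  simp_rw [← charFun_apply_real, charFun_gaussianReal, ← Complex.exp_sum]
  congr 1
  have hv' : ∑ i, (v i : ℂ) ^ 2 = 1 := by exact_mod_cast congrArg Complex.ofReal hv
  push_cast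
  simp only [mul_zero, zero_mul, zero_sub, Finset.sum_neg_distrib, mul_pow]
  rw [← Finset.sum_div, ← Finset.mul_sum, ← Finset.mul_sum, hv', mul_one]

lemma gaussianReal_sq_le (t : ℝ) (ht : 0 ≤ t) :
    gaussianReal 0 (1 / 2) {x | x ^ 2 ≤ t ^ 2} ≤ ENNReal.ofReal (2 * t) := by
  have hset : {x : ℝ | x ^ 2 ≤ t ^ 2} = Set.Icc (-t) t := by
    ext x
    rw [Set.mem_ofPred_eq, sq_le_sq, abs_of_nonneg ht, abs_le, Set.mem_Icc]
  rw [hset, gaussianReal_apply 0 (by norm_num)]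
  have hle : ∀ x, gaussianPDF 0 (1 / 2) x ≤ 1 := by
    intro x
    rw [gaussianPDF, ENNReal.ofReal_le_one, gaussianPDFReal]
    refine mul_le_one₀ (inv_le_one_of_one_le₀ ?_) (Real.exp_pos _).le ?_
    · rw [Real.one_le_sqrt]
      push_cast
      linarith [Real.pi_gt_three]
    · rw [Real.exp_le_one_iff, neg_div]
      have : 0 ≤ (x - 0) ^ 2 / (2 * ((1 / 2 : NNReal) : ℝ)) := by positivity
      linarith
  calc ∫⁻ x in Set.Icc (-t) t, gaussianPDF 0 (1 / 2) x ≤ ∫⁻ _ in Set.Icc (-t) t, 1 :=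
        lintegral_mono fun x => hle x
    _ = ENNReal.ofReal (2 * t) := by
        rw [setLIntegral_one, Real.volume_Icc]
        ring_nf

lemma gaussianMeasure_sum_mul_sq_le {N : ℕ} (v : Fin N → ℝ) (hv : ∑ i, v i ^ 2 = 1) {t : ℝ}
    (ht : 0 ≤ t) :
    gaussianMeasure N {a | (∑ i, a i * v i) ^ 2 ≤ t ^ 2} ≤ ENNReal.ofReal (2 * t) := by
  refine le_trans (le_of_eq ?_) (gaussianReal_sq_le t ht)
  rw [← map_sum_mul_gaussianMeasure v hv, Measure.map_apply (by fun_prop)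
    (measurableSet_le (by fun_prop) (by fun_prop))]
  rfl

lemma gaussianMeasure_le_sum_sq (N : ℕ) {T : ℝ} (hT : 0 < T) :
    gaussianMeasure N {a | T ≤ ∑ i, a i ^ 2} ≤ ENNReal.ofReal (N / (2 * T)) := by
  rw [gaussianMeasure_eq_pi]
  set μ : Measure (Fin N → ℝ) := Measure.pi fun _ => gaussianReal 0 (1 / 2)
  have hsq : Integrable (fun x : ℝ => x ^ 2) (gaussianReal 0 (1 / 2)) :=
    (memLp_id_gaussianReal 2).integrable_sq
  have hval : ∫ x : ℝ, x ^ 2 ∂gaussianReal 0 (1 / 2) = 1 / 2 := by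
    have h := variance_of_integral_eq_zero (μ := gaussianReal 0 (1 / 2)) (X := fun x : ℝ => x)
      (by fun_prop) integral_id_gaussianReal
    rw [variance_fun_id_gaussianReal] at h
    rw [← h]
    norm_num
  have hint : ∀ i, Integrable (fun a : Fin N → ℝ => a i ^ 2) μ := fun i =>
    integrable_comp_eval (μ := fun _ : Fin N => gaussianReal 0 (1 / 2)) (i := i) hsq
  have hE : ∫ a, ∑ i, a i ^ 2 ∂μ = N / 2 := by
    rw [integral_finsetSum _ fun i _ => hint i]
    have : ∀ i, ∫ a, a i ^ 2 ∂μ = 1 / 2 := fun i => by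
      rw [← hval]
      exact integral_comp_eval (μ := fun _ : Fin N => gaussianReal 0 (1 / 2)) (i := i)
        (f := fun x : ℝ => x ^ 2) hsq.aestronglyMeasurable
    simp_rw [this]
    simp [div_eq_mul_inv]
  have hM := mul_meas_ge_le_integral_of_nonneg (μ := μ) (f := fun a => ∑ i, a i ^ 2)
    (ae_of_all _ fun a => Finset.sum_nonneg fun i _ => sq_nonneg _)
    (integrable_finsetSum _ fun i _ => hint i) T
  rw [hE] at hM
  rw [← ofReal_measureReal]
  refine ENNReal.ofReal_le_ofReal ?_
  rw [le_div_iff₀ (by positivity)]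
  linarith

open Polynomial in
lemma ncard_kostlanPoly_zeros_le (d : ℕ) (a : Fin (d + 1) → ℝ)
    (ha : (fun x => kostlanPoly d a x) ≠ 0) : Set.ncard {x : ℝ | kostlanPoly d a x = 0} ≤ d := by
  set p : ℝ[X] := ∑ j : Fin (d + 1), C (a j * √((d + 1).factorial /
    ((j : ℕ).factorial * (d - (j : ℕ)).factorial))) * X ^ (j : ℕ)
  have hp : ∀ x, p.eval x = kostlanPoly d a x := fun x => by
    simp [p, kostlanPoly, eval_finsetSum]
  have hp0 : p ≠ 0 := by
    intro h
    refine ha (funext fun x => ?_)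
    rw [← hp, h, eval_zero, Pi.zero_apply]
  have hset : {x : ℝ | kostlanPoly d a x = 0} = p.roots.toFinset := by
    ext x
    simp [hp0, hp]
  have hdeg : p.natDegree ≤ d := natDegree_sum_le_of_forall_le _ _ fun j _ =>
    (natDegree_C_mul_X_pow_le _ _).trans (Nat.lt_succ_iff.1 j.2)
  rw [hset, Set.ncard_coe_finset]
  exact (Multiset.toFinset_card_le _).trans ((card_roots' p).trans hdeg)

lemma gaussianMeasure_many_zeros_le (d : ℕ) (hd : 1 ≤ d) {e : ℝ} (he : 1 ≤ e) (hed : e ≤ √d) :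
    gaussianMeasure (d + 1)
        {a | e * √d ≤ Set.ncard {x : ℝ | kostlanPoly d a x = 0}} ≤
      ENNReal.ofReal (2003 * (d : ℝ) ^ (3 / 2 : ℝ) * Real.exp (-e ^ 2 / 16000)) := by
  have he0 : 0 < e := by linarith
  set m := ⌈1000 * √d / e⌉₊
  set q := Real.exp (-e ^ 2 / 16000)
  have hq : 0 < q := Real.exp_pos _
  have hq1 : q ≤ 1 := Real.exp_le_one_iff.2 (by nlinarith)
  have hq4 : Real.exp (-e ^ 2 / 4000) = q ^ 4 := by
    rw [← Real.exp_nat_mul]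
    ring_nf
  set v : ℕ → Fin (d + 1) → ℝ := fun i => kostlanVector d (i * (Real.pi / m) - Real.pi / 2)
  have hsub : {a | e * √d ≤ Set.ncard {x : ℝ | kostlanPoly d a x = 0}} ⊆
      {a : Fin (d + 1) → ℝ | (q ^ 2)⁻¹ ≤ ∑ i, a i ^ 2} ∪
        ⋃ i ∈ Finset.range m, {a | (∑ j, a j * v i j) ^ 2 ≤ q ^ 2} := by
    intro a ha
    obtain ⟨i, hi, h⟩ := exists_kostlan_small d hd a he0 hed ha
    by_cases hT : (q ^ 2)⁻¹ ≤ ∑ i, a i ^ 2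
    · exact Or.inl hT
    · refine Or.inr (Set.mem_biUnion hi (h.trans ?_))
      rw [hq4]
      calc (∑ j, a j ^ 2) * q ^ 4 ≤ (q ^ 2)⁻¹ * q ^ 4 := by gcongr; exact (not_le.1 hT).le
        _ = q ^ 2 := by field_simp
  have hs1 : 1 ≤ √(d : ℝ) := he.trans hed
  have hsd : √(d : ℝ) ^ 2 = d := Real.sq_sqrt (by positivity)
  have hd32 : (d : ℝ) ^ (3 / 2 : ℝ) = √d ^ 3 := by
    rw [Real.sqrt_eq_rpow, ← Real.rpow_natCast, ← Real.rpow_mul (by positivity)]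
    norm_num
  have hm : (m : ℝ) ≤ 1001 * √d := by
    have h1 : (m : ℝ) < 1000 * √(d : ℝ) / e + 1 := Nat.ceil_lt_add_one (by positivity)
    have h2 : 1000 * √(d : ℝ) / e ≤ 1000 * √d := div_le_self (by positivity) he
    linarith
  calc _ ≤ _ := measure_mono hsub
    _ ≤ _ := measure_union_le _ _
    _ ≤ ENNReal.ofReal ((d + 1 : ℕ) / (2 * (q ^ 2)⁻¹)) + ENNReal.ofReal (m * (2 * q)) := by
      refine add_le_add (gaussianMeasure_le_sum_sq _ (by positivity)) ?_
      refine (measure_biUnion_finset_le _ _).trans ((Finset.sum_le_sum fun i _ =>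
        gaussianMeasure_sum_mul_sq_le (v i) (sum_kostlanVector_sq d _) hq.le).trans_eq ?_)
      rw [Finset.sum_const, Finset.card_range, nsmul_eq_mul, ← ENNReal.ofReal_natCast,
        ← ENNReal.ofReal_mul (by positivity)]
    _ ≤ _ := by
      rw [← ENNReal.ofReal_add (by positivity) (by positivity)]
      refine ENNReal.ofReal_le_ofReal ?_
      rw [hd32]
      set s := √(d : ℝ)
      have h1 : ((d + 1 : ℕ) : ℝ) / (2 * (q ^ 2)⁻¹) = (s ^ 2 + 1) / 2 * q ^ 2 := by
        rw [hsd]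
        push_cast
        field_simp
      have h2 : (s ^ 2 + 1) / 2 ≤ s ^ 3 := by nlinarith [pow_le_pow_right₀ hs1 (show 2 ≤ 3 by simp)]
      have h3 : s ≤ s ^ 3 := le_self_pow₀ hs1 (by simp)
      have h4 : q ^ 2 ≤ q := by nlinarith
      rw [h1]
      calc (s ^ 2 + 1) / 2 * q ^ 2 + m * (2 * q) ≤ s ^ 3 * q + 1001 * s ^ 3 * (2 * q) := by
            gcongr
            exact hm.trans (by gcongr)
        _ = _ := by ring

/-- Exponential rarefaction of real roots: for every sequence `ε(d)` of positive rationals,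
there exist `C, D > 0` such that for every `d ≥ 1` the Gaussian measure of the set of
coefficient vectors `a ∈ ℝ^{d+1}` whose Kostlan polynomial is nonzero and has at least
`ε(d)·√d` distinct real roots is at most `C·d^{3/2}·exp(−D·ε(d)²)`. -/
theorem rarefaction_real_roots (ε : ℕ → ℚ) (hε : ∀ d, 1 ≤ d → 0 < ε d) :
    ∃ C D : ℝ, 0 < C ∧ 0 < D ∧ ∀ d : ℕ, 1 ≤ d →
      gaussianMeasure (d + 1)
        {a : Fin (d + 1) → ℝ |
          (fun x => kostlanPoly d a x) ≠ 0 ∧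
          (ε d : ℝ) * Real.sqrt d ≤ Set.ncard {x : ℝ | kostlanPoly d a x = 0}}
      ≤ ENNReal.ofReal (C * (d : ℝ) ^ ((3 : ℝ) / 2) * Real.exp (-D * (ε d : ℝ) ^ 2)) := by
  refine ⟨2003, 1 / 16000, by norm_num, by norm_num, fun d hd => ?_⟩
  have he := hε d hd
  generalize ε d = q at he
  have he' : (0 : ℝ) < q := by exact_mod_cast he
  have hd1 : (1 : ℝ) ≤ d := by exact_mod_cast hd
  rcases lt_or_ge (q : ℝ) 1 with hlt | hge
  · have hprob : IsProbabilityMeasure (gaussianMeasure (d + 1)) := by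
      rw [gaussianMeasure_eq_pi]
      infer_instance
    refine prob_le_one.trans ?_
    rw [ENNReal.one_le_ofReal]
    have h1 : (1 : ℝ) ≤ (d : ℝ) ^ ((3 : ℝ) / 2) := Real.one_le_rpow hd1 (by norm_num)
    have h2 : 1 / 2 ≤ Real.exp (-(1 / 16000) * (q : ℝ) ^ 2) := by
      have := Real.add_one_le_exp (-(1 / 16000) * (q : ℝ) ^ 2)
      nlinarith
    nlinarith
  rcases le_or_gt (q : ℝ) (√d) with hle | hgt
  · refine (measure_mono fun a ha => ha.2).trans
      ((gaussianMeasure_many_zeros_le d hd hge hle).trans_eq ?_)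
    congr 3
    ring
  · refine (measure_mono_null (t := ∅) ?_ measure_empty).trans_le (by positivity)
    refine (Set.eq_empty_of_forall_notMem fun a ha => ?_).subset
    have h1 : (Set.ncard {x : ℝ | kostlanPoly d a x = 0} : ℝ) ≤ d := by
      exact_mod_cast ncard_kostlanPoly_zeros_le d a ha.1
    have h2 : √(d : ℝ) * √d = d := Real.mul_self_sqrt (by positivity)
    have h3 : 0 < √(d : ℝ) := by positivity
    nlinarith [ha.2]
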